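/- Let L : ℝ^D × ℝ^D → ℝ be twice continuously differentiable, with velocity Hessian M(q,v), antisymmetric matrix F(q,v), energy E(q,v) = ⟨v, ∂L/∂v⟩ − L, and Lagrangian two-form Ω_L(q,v) as defined. Then for every K = (Kq,Kv) ∈ ker Ω_L(q,v), the derivative of E at (q,v) in the direction K equals the first-order constraint value at Kq: dE(q,v)(K) = ⟨Kq, ∇_q E(q,v) + F(q,v)·v⟩. (In particular, for K with Kq = z ∈ ker M(q,v), this gives γ_z^{[1]} = i_K dE.) -/

import Mathlib

open Matrix

/-- Gradient of `L` in the velocity variables: `(∇_v L)_a = ∂L/∂v^a`. -/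
noncomputable def gradV (D : ℕ) (L : (Fin D → ℝ) × (Fin D → ℝ) → ℝ)
    (u : (Fin D → ℝ) × (Fin D → ℝ)) : Fin D → ℝ :=
  fun a => fderiv ℝ L u (0, Pi.single a 1)

/-- Gradient of a phase-space function in the position variables. -/
noncomputable def gradQ (D : ℕ) (f : (Fin D → ℝ) × (Fin D → ℝ) → ℝ)
    (u : (Fin D → ℝ) × (Fin D → ℝ)) : Fin D → ℝ :=
  fun a => fderiv ℝ f u (Pi.single a 1, 0)

/-- The fibre derivative (Legendre map) `FL(q,v) = (q, ∂L/∂v(q,v))`. -/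
noncomputable def FL (D : ℕ) (L : (Fin D → ℝ) × (Fin D → ℝ) → ℝ) :
    (Fin D → ℝ) × (Fin D → ℝ) → (Fin D → ℝ) × (Fin D → ℝ) :=
  fun u => (u.1, gradV D L u)

/-- The velocity Hessian `M_{ab} = ∂²L/∂v^a∂v^b`. -/
noncomputable def hessV (D : ℕ) (L : (Fin D → ℝ) × (Fin D → ℝ) → ℝ)
    (u : (Fin D → ℝ) × (Fin D → ℝ)) : Matrix (Fin D) (Fin D) ℝ :=
  Matrix.of fun a b =>
    fderiv ℝ (fun w => fderiv ℝ L w (0, Pi.single a 1)) u (0, Pi.single b 1)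

/-- The antisymmetric matrix `F_{ab} = ∂²L/∂v^a∂q^b − ∂²L/∂v^b∂q^a`. -/
noncomputable def Fmat (D : ℕ) (L : (Fin D → ℝ) × (Fin D → ℝ) → ℝ)
    (u : (Fin D → ℝ) × (Fin D → ℝ)) : Matrix (Fin D) (Fin D) ℝ :=
  Matrix.of fun a b =>
    fderiv ℝ (fun w => fderiv ℝ L w (0, Pi.single a 1)) u (Pi.single b 1, 0)
      - fderiv ℝ (fun w => fderiv ℝ L w (0, Pi.single b 1)) u (Pi.single a 1, 0)

/-- The energy `E(q,v) = ⟨v, ∂L/∂v⟩ − L(q,v)`. -/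
noncomputable def energy (D : ℕ) (L : (Fin D → ℝ) × (Fin D → ℝ) → ℝ)
    (u : (Fin D → ℝ) × (Fin D → ℝ)) : ℝ :=
  u.2 ⬝ᵥ gradV D L u - L u

/-- The presymplectic Lagrangian two-form
`Ω((Xq,Xv),(Yq,Yv)) = Σ F_{ab} Xq^a Yq^b + Σ M_{ab}(Xq^a Yv^b − Yq^a Xv^b)`
on `ℝ^D × ℝ^D`. -/
def Omega (D : ℕ) (M F : Matrix (Fin D) (Fin D) ℝ)
    (X Y : (Fin D → ℝ) × (Fin D → ℝ)) : ℝ :=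
  X.1 ⬝ᵥ F.mulVec Y.1 + X.1 ⬝ᵥ M.mulVec Y.2 - Y.1 ⬝ᵥ M.mulVec X.2

/-- The canonical symplectic bilinear pairing `ω((a,b),(c,d)) = ⟨a,d⟩ − ⟨c,b⟩`. -/
def omegaCan (D : ℕ) (X Y : (Fin D → ℝ) × (Fin D → ℝ)) : ℝ :=
  X.1 ⬝ᵥ Y.2 - Y.1 ⬝ᵥ X.2

theorem hasFDerivAt_gradV_apply (D : ℕ) {L : (Fin D → ℝ) × (Fin D → ℝ) → ℝ}
    (hL : ContDiff ℝ 2 L) (u : (Fin D → ℝ) × (Fin D → ℝ)) (a : Fin D) :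
    HasFDerivAt (fun w => gradV D L w a)
      (fderiv ℝ (fun w => fderiv ℝ L w (0, Pi.single a 1)) u) u := by
  have h : Differentiable ℝ (fderiv ℝ L) :=
    (hL.fderiv_right (m := 1) (by norm_num)).differentiable one_ne_zero
  exact ((h u).clm_apply (differentiableAt_const _)).hasFDerivAt

theorem hasFDerivAt_energy (D : ℕ) {L : (Fin D → ℝ) × (Fin D → ℝ) → ℝ}
    (hL : ContDiff ℝ 2 L) (u : (Fin D → ℝ) × (Fin D → ℝ)) :
    HasFDerivAt (energy D L)
      ((∑ a, (u.2 a • fderiv ℝ (fun w => fderiv ℝ L w (0, Pi.single a 1)) u +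
        gradV D L u a • (ContinuousLinearMap.proj a ∘L
          ContinuousLinearMap.snd ℝ (Fin D → ℝ) (Fin D → ℝ)))) - fderiv ℝ L u) u := by
  refine HasFDerivAt.sub (HasFDerivAt.fun_sum fun a _ => ?_)
    (hL.differentiable two_ne_zero u).hasFDerivAt
  have hproj : HasFDerivAt (fun w : (Fin D → ℝ) × (Fin D → ℝ) => w.2 a)
      (ContinuousLinearMap.proj a ∘L ContinuousLinearMap.snd ℝ (Fin D → ℝ) (Fin D → ℝ)) u :=
    (ContinuousLinearMap.proj (R := ℝ) (φ := fun _ : Fin D => ℝ) a ∘L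
      ContinuousLinearMap.snd ℝ (Fin D → ℝ) (Fin D → ℝ)).hasFDerivAt
  exact hproj.mul (hasFDerivAt_gradV_apply D hL u a)

theorem clm_apply_fst_eq_sum (D : ℕ) (T : (Fin D → ℝ) × (Fin D → ℝ) →L[ℝ] ℝ)
    (x : Fin D → ℝ) : T (x, 0) = ∑ b, x b * T (Pi.single b 1, 0) := by
  have h (b : Fin D) : (fun j => if b = j then (1 : ℝ) else 0) = Pi.single b 1 := by
    ext j
    simp [Pi.single_apply, eq_comm]
  simpa [h] using LinearMap.pi_apply_eq_sum_univ
    (T.toLinearMap ∘ₗ LinearMap.inl ℝ (Fin D → ℝ) (Fin D → ℝ)) x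

theorem clm_apply_snd_eq_sum (D : ℕ) (T : (Fin D → ℝ) × (Fin D → ℝ) →L[ℝ] ℝ)
    (x : Fin D → ℝ) : T (0, x) = ∑ b, x b * T (0, Pi.single b 1) := by
  have h (b : Fin D) : (fun j => if b = j then (1 : ℝ) else 0) = Pi.single b 1 := by
    ext j
    simp [Pi.single_apply, eq_comm]
  simpa [h] using LinearMap.pi_apply_eq_sum_univ
    (T.toLinearMap ∘ₗ LinearMap.inr ℝ (Fin D → ℝ) (Fin D → ℝ)) x

theorem fderiv_energy_vertical (D : ℕ) {L : (Fin D → ℝ) × (Fin D → ℝ) → ℝ}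
    (hL : ContDiff ℝ 2 L) (u : (Fin D → ℝ) × (Fin D → ℝ)) (x : Fin D → ℝ) :
    fderiv ℝ (energy D L) u (0, x) = u.2 ⬝ᵥ (hessV D L u).mulVec x := by
  have hM (a : Fin D) : fderiv ℝ (fun w => fderiv ℝ L w (0, Pi.single a 1)) u (0, x) =
      (hessV D L u).mulVec x a := by
    rw [clm_apply_snd_eq_sum]
    exact Finset.sum_congr rfl fun b _ => mul_comm _ _
  have hg : fderiv ℝ L u (0, x) = ∑ a, gradV D L u a * x a := by
    rw [clm_apply_snd_eq_sum]
    exact Finset.sum_congr rfl fun b _ => mul_comm _ _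
  rw [(hasFDerivAt_energy D hL u).fderiv]
  simp [hM, hg, Finset.sum_add_distrib, dotProduct]

/-- **Theorem (`γ^{[1]} = i_K dE` on `ker Ω_L`).**
For every `K = (Kq,Kv)` in the kernel of the Lagrangian two-form at `(q,v)`,
`dE(q,v)(K) = ⟨Kq, ∇_q E(q,v) + F(q,v)·v⟩`; in particular for `Kq = z ∈ ker M(q,v)`
this is the first-order constraint function `γ_z^{[1]}`. -/
theorem dE_on_ker_OmegaL (D : ℕ)
    (L : (Fin D → ℝ) × (Fin D → ℝ) → ℝ) (hL : ContDiff ℝ 2 L)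
    (u : (Fin D → ℝ) × (Fin D → ℝ)) :
    ∀ K : (Fin D → ℝ) × (Fin D → ℝ),
      (∀ Y, Omega D (hessV D L u) (Fmat D L u) K Y = 0) →
      fderiv ℝ (energy D L) u K =
        K.1 ⬝ᵥ (gradQ D (energy D L) u + (Fmat D L u).mulVec u.2) := by
  intro K hK
  have hker : K.1 ⬝ᵥ (Fmat D L u).mulVec u.2 = u.2 ⬝ᵥ (hessV D L u).mulVec K.2 := by
    simpa [Omega, sub_eq_zero] using hK (u.2, 0)
  have hq : fderiv ℝ (energy D L) u (K.1, 0) = K.1 ⬝ᵥ gradQ D (energy D L) u :=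
    clm_apply_fst_eq_sum D _ K.1
  have hsplit : K = (K.1, 0) + (0, K.2) := by simp
  rw [dotProduct_add, hker, ← hq, ← fderiv_energy_vertical D hL, ← map_add, ← hsplit]
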